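/- Fix n, m ∈ ℤ_{≥0} and let θ > 0 be irrational (or more generally θ ≠ i/j for all integers 1 ≤ i ≤ m, 1 ≤ j ≤ n, and θ not a nonpositive rational). For a partition λ, define the generalized Pochhammer symbol (a)_λ^{(θ)} = ∏_{i=1}^{ℓ(λ)} (a − θ(i−1))_{λ_i}, where (a)_k is the ordinary rising factorial. Then (θn − m)_λ^{(θ)} = 0 if and only if the box (n+1, m+1) belongs to the Young diagram of λ, i.e. if and only if λ_{n+1} ≥ m+1. -/

import Mathlib

open Finset

/-- The rising factorial `(a)_k = a(a+1)⋯(a+k-1)`. -/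
noncomputable def risingFac (a : ℝ) (k : ℕ) : ℝ := ∏ j ∈ Finset.range k, (a + j)

theorem risingFac_eq_zero_iff (a : ℝ) (k : ℕ) : risingFac a k = 0 ↔ ∃ j < k, a + j = 0 := by
  simp [risingFac, Finset.prod_eq_zero_iff]

/-- For `θ > 0` with `θ ≠ i/j` for all `1 ≤ i ≤ m`, `1 ≤ j ≤ n`, the generalised
Pochhammer symbol `(θn - m)_λ^{(θ)} = ∏_i ((θn - m) - θ(i-1))_{λ_i}` vanishes if and
only if the box `(n+1, m+1)` lies in the Young diagram of `λ`, i.e. `λ_{n+1} ≥ m+1`.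
(Here the partition `λ` is 0-indexed: `l k = λ_{k+1}`, with `l` antitone and
vanishing from `N` on.) -/
theorem genPochhammer_eq_zero_iff (n m : ℕ) (θ : ℝ) (hθ : 0 < θ)
    (hθ' : ∀ i j : ℕ, 1 ≤ i → i ≤ m → 1 ≤ j → j ≤ n → θ ≠ (i : ℝ) / (j : ℝ))
    (l : ℕ → ℕ) (hl : Antitone l) (N : ℕ) (hN : ∀ k, N ≤ k → l k = 0) :
    (∏ i ∈ Finset.range N, risingFac (θ * n - m - θ * i) (l i)) = 0 ↔ m + 1 ≤ l n := by
  simp only [Finset.prod_eq_zero_iff, risingFac_eq_zero_iff, Finset.mem_range]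
  constructor
  · rintro ⟨i, -, j, hj, h⟩
    rcases lt_or_ge i n with hin | hni
    · exfalso
      have hin' : (0 : ℝ) < (n : ℝ) - i := sub_pos.mpr (by exact_mod_cast hin)
      have hjm : j < m := by
        have : (j : ℝ) < m := by nlinarith [mul_pos hθ hin']
        exact_mod_cast this
      refine hθ' (m - j) (n - i) (by omega) (by omega) (by omega) (by omega) ?_
      rw [Nat.cast_sub hjm.le, Nat.cast_sub hin.le, eq_div_iff hin'.ne']
      linarith
    · have hni' : (0 : ℝ) ≤ (i : ℝ) - n := sub_nonneg.mpr (by exact_mod_cast hni)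
      have hmj : m ≤ j := by
        have : (m : ℝ) ≤ j := by nlinarith [mul_nonneg hθ.le hni']
        exact_mod_cast this
      have := hl hni
      omega
  · intro h
    refine ⟨n, ?_, m, h, by ring⟩
    by_contra! hn
    have := hN n hn
    omega
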